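/- Let R be a one-dimensional Cohen-Macaulay semi-local Arf ring and I an ideal of R containing a nonzerodivisor. Then the following are equivalent: (a) I is isomorphic as an R-module to some trace ideal of R; (b) I is isomorphic as an R-module to some integrally closed ideal of R; (c) I is reflexive as an R-module. -/

import Mathlib

/-- The trace ideal of an `R`-module `M`: the sum of the images of all
`R`-linear maps `M → R`. -/
def traceIdeal (R : Type*) [CommRing R] (M : Type*) [AddCommGroup M] [Module R M] : Ideal R :=
  ⨆ f : M →ₗ[R] R, LinearMap.range f

/-- `x` is integral over the ideal `I`: there are `n ≥ 1` and `a_i ∈ I^i` with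
`x^n + a_1 x^{n-1} + ... + a_n = 0`. -/
def IsIntegralOverIdeal {R : Type*} [CommRing R] (I : Ideal R) (x : R) : Prop :=
  ∃ n : ℕ, 0 < n ∧ ∃ a : ℕ → R, (∀ i, 1 ≤ i → i ≤ n → a i ∈ I ^ i) ∧
    x ^ n + ∑ i ∈ Finset.Icc 1 n, a i * x ^ (n - i) = 0

/-- An ideal is integrally closed if it contains every element integral over it. -/
def IsIntegrallyClosedIdeal {R : Type*} [CommRing R] (I : Ideal R) : Prop :=
  ∀ x : R, IsIntegralOverIdeal I x → x ∈ I

/-- A ring `R` is an Arf ring if for every integrally closed ideal `I` of `R` containing a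
nonzerodivisor there exists `a ∈ I` with `I² = aI`. -/
def IsArfRing (R : Type*) [CommRing R] : Prop :=
  ∀ I : Ideal R, IsIntegrallyClosedIdeal I → (∃ x ∈ I, x ∈ nonZeroDivisors R) →
    ∃ a ∈ I, I ^ 2 = Ideal.span {a} * I

/-- A one-dimensional Cohen-Macaulay semi-local ring: a commutative Noetherian ring with
finitely many maximal ideals, all of whose localizations at maximal ideals are Noetherian
local rings of Krull dimension one whose maximal ideal contains a nonzerodivisor. -/
def IsOneDimCMSemiLocal (R : Type*) [CommRing R] : Prop :=
  IsNoetherianRing R ∧ {I : Ideal R | I.IsMaximal}.Finite ∧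
  ∀ m : Ideal R, (hm : m.IsMaximal) →
    letI := hm.isPrime
    ringKrullDim (Localization.AtPrime m) = 1 ∧
    ∃ x ∈ IsLocalRing.maximalIdeal (Localization.AtPrime m),
      x ∈ nonZeroDivisors (Localization.AtPrime m)

open scoped nonZeroDivisors

section IntegralClosure

variable {R : Type*} [CommRing R]

/-- The determinant trick: `x` is integral over `I` as soon as `x L ⊆ I L` for an ideal `L`
containing a nonzerodivisor. -/
theorem IsIntegralOverIdeal.of_span_mul_le [IsNoetherianRing R] {I L : Ideal R} {x : R}
    (hL : ∃ y ∈ L, y ∈ R⁰) (h : Ideal.span {x} * L ≤ I * L) : IsIntegralOverIdeal I x := by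
  obtain ⟨y, hyL, hy⟩ := hL
  obtain ⟨p, hp, -, hcoeff, hpx⟩ :=
    LinearMap.exists_monic_and_natDegree_eq_and_coeff_mem_pow_and_aeval_eq_zero R
      (algebraMap R (Module.End R L) x) I (by
        rintro _ ⟨z, rfl⟩
        have hz : x * (z : R) ∈ I * L :=
          h (Ideal.mul_mem_mul (Ideal.mem_span_singleton_self x) z.2)
        have : (I • (⊤ : Submodule R L)).map L.subtype = I * L := by
          rw [Submodule.map_smul'', Submodule.map_top, Submodule.range_subtype, smul_eq_mul]
        rw [← this] at hz
        obtain ⟨w, hw, hwz⟩ := hz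
        rwa [show (algebraMap R (Module.End R L) x) z = w from Subtype.ext hwz.symm])
  have heval : p.eval x = 0 := by
    rw [Polynomial.aeval_algebraMap_apply] at hpx
    have := congrArg (fun f : Module.End R L => ((f ⟨y, hyL⟩ : L) : R)) hpx
    simp only [Module.algebraMap_end_apply, SetLike.mk_smul_mk, smul_eq_mul,
      LinearMap.zero_apply, ZeroMemClass.coe_zero, Polynomial.coe_aeval_eq_eval] at this
    exact (mem_nonZeroDivisors_iff.mp hy).2 _ this
  rcases Nat.eq_zero_or_pos p.natDegree with h0 | hpos
  · rw [Polynomial.Monic.natDegree_eq_zero hp] at h0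
    have : Subsingleton R := subsingleton_of_zero_eq_one (by simpa [h0] using heval.symm)
    exact ⟨1, one_pos, 0, fun i _ _ => by simp, Subsingleton.elim _ _⟩
  · refine ⟨p.natDegree, hpos, fun i => p.coeff (p.natDegree - i), fun i _ hi => ?_, ?_⟩
    · simpa [Nat.sub_sub_self hi] using hcoeff (p.natDegree - i)
    · rw [← heval, Polynomial.eval_eq_sum_range, ← Finset.sum_range_reflect,
        Finset.sum_range_succ', add_comm]
      simp only [add_tsub_cancel_right, tsub_zero, hp.coeff_natDegree, one_mul]
      congr 1
      rw [Finset.range_eq_Ico, Finset.sum_Ico_add'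
        (fun i => p.coeff (p.natDegree - i) * x ^ (p.natDegree - i))]
      rfl

theorem Ideal.sup_span_singleton_pow_succ_le (I : Ideal R) (x : R) (n : ℕ) :
    (I ⊔ span {x}) ^ (n + 1) ≤ I * (I ⊔ span {x}) ^ n ⊔ span {x ^ (n + 1)} := by
  induction n with
  | zero => simp
  | succ n ih =>
    rw [pow_succ]
    refine (Ideal.mul_mono_left ih).trans ?_
    rw [Ideal.sup_mul, mul_assoc, ← pow_succ, Ideal.mul_sup, Ideal.span_singleton_mul_span_singleton,
      ← pow_succ]
    refine sup_le le_sup_left (sup_le (le_sup_of_le_left ?_) le_sup_right)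
    rw [mul_comm]
    exact Ideal.mul_mono_right ((Ideal.span_singleton_le_iff_mem _).mpr
      (Ideal.pow_mem_pow (le_sup_right (a := I) (Ideal.mem_span_singleton_self x)) _))

theorem IsIntegralOverIdeal.exists_span_mul_le {I : Ideal R} {x : R} (hI : ∃ y ∈ I, y ∈ R⁰)
    (h : IsIntegralOverIdeal I x) :
    ∃ L : Ideal R, (∃ y ∈ L, y ∈ R⁰) ∧ Ideal.span {x} * L ≤ I * L := by
  obtain ⟨y, hyI, hy⟩ := hI
  obtain ⟨n, hn, a, ha, hx⟩ := h
  obtain ⟨n, rfl⟩ : ∃ k, n = k + 1 := ⟨n - 1, by omega⟩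
  have hxK : x ∈ I ⊔ Ideal.span {x} := Ideal.mem_sup_right (Ideal.mem_span_singleton_self x)
  refine ⟨(I ⊔ Ideal.span {x}) ^ n, ⟨y ^ n, Ideal.pow_mem_pow (Ideal.mem_sup_left hyI) n,
    pow_mem hy n⟩, ?_⟩
  calc Ideal.span {x} * (I ⊔ Ideal.span {x}) ^ n
      ≤ (I ⊔ Ideal.span {x}) ^ (n + 1) := by
        rw [pow_succ']; exact Ideal.mul_mono_left le_sup_right
    _ ≤ _ := I.sup_span_singleton_pow_succ_le x n
    _ ≤ _ := by
        refine sup_le le_rfl ((Ideal.span_singleton_le_iff_mem _).mpr ?_)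
        rw [eq_neg_of_add_eq_zero_left hx]
        refine neg_mem (sum_mem fun i hi => ?_)
        obtain ⟨hi1, hi2⟩ := Finset.mem_Icc.mp hi
        obtain ⟨i, rfl⟩ : ∃ k, i = k + 1 := ⟨i - 1, by omega⟩
        have h1 := Ideal.mul_mem_mul (ha _ hi1 hi2) (Ideal.pow_mem_pow hxK (n + 1 - (i + 1)))
        refine (?_ : I ^ (i + 1) * _ ≤ _) h1
        rw [pow_succ', mul_assoc]
        refine Ideal.mul_mono_right ?_
        calc _ ≤ (I ⊔ Ideal.span {x}) ^ i * (I ⊔ Ideal.span {x}) ^ (n + 1 - (i + 1)) :=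
              Ideal.mul_mono_left (Ideal.pow_right_mono le_sup_left i)
          _ = _ := by rw [← pow_add]; congr 1; omega

/-- The ideal of those `x` with `x L ⊆ I L` for some ideal `L` containing a nonzerodivisor.
In a Noetherian ring it is the integral closure of `I` if `I` contains a nonzerodivisor. -/
def Ideal.regularIntegralClosure (I : Ideal R) : Ideal R where
  carrier := {x | ∃ L : Ideal R, (∃ y ∈ L, y ∈ R⁰) ∧ Ideal.span {x} * L ≤ I * L}
  zero_mem' := ⟨⊤, ⟨1, trivial, one_mem _⟩, by simp⟩
  add_mem' := by
    rintro x x' ⟨L, ⟨y, hyL, hy⟩, h⟩ ⟨L', ⟨y', hyL', hy'⟩, h'⟩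
    refine ⟨L * L', ⟨y * y', Ideal.mul_mem_mul hyL hyL', mul_mem hy hy'⟩, ?_⟩
    have : Ideal.span {x + x'} ≤ Ideal.span {x} ⊔ Ideal.span {x'} :=
      (Ideal.span_singleton_le_iff_mem _).mpr (Submodule.add_mem_sup
        (Ideal.mem_span_singleton_self x) (Ideal.mem_span_singleton_self x'))
    refine (Ideal.mul_mono_left this).trans ?_
    rw [Ideal.sup_mul]
    refine sup_le ?_ ?_
    · rw [← mul_assoc, ← mul_assoc]; exact Ideal.mul_mono_left h
    · rw [mul_left_comm, mul_left_comm I]; exact Ideal.mul_mono_right h'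
  smul_mem' := by
    rintro r x ⟨L, hL, h⟩
    refine ⟨L, hL, (Ideal.mul_mono_left ?_).trans h⟩
    exact (Ideal.span_singleton_le_iff_mem _).mpr
      (Ideal.mul_mem_left _ r (Ideal.mem_span_singleton_self x))

theorem Ideal.mem_regularIntegralClosure {I : Ideal R} {x : R} :
    x ∈ I.regularIntegralClosure ↔
      ∃ L : Ideal R, (∃ y ∈ L, y ∈ R⁰) ∧ Ideal.span {x} * L ≤ I * L :=
  Iff.rfl

theorem Ideal.le_regularIntegralClosure (I : Ideal R) : I ≤ I.regularIntegralClosure :=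
  fun _ hx => ⟨⊤, ⟨1, trivial, one_mem _⟩,
    Ideal.mul_mono_left ((Ideal.span_singleton_le_iff_mem _).mpr hx)⟩

theorem Ideal.exists_mul_le_of_le_regularIntegralClosure {I C : Ideal R} (hC : C.FG)
    (h : C ≤ I.regularIntegralClosure) :
    ∃ L : Ideal R, (∃ y ∈ L, y ∈ R⁰) ∧ C * L ≤ I * L := by
  induction C, hC using Submodule.fg_induction with
  | singleton x => exact h (Ideal.mem_span_singleton_self x)
  | sup C C' _ _ ih ih' =>
    obtain ⟨L, ⟨y, hyL, hy⟩, hL⟩ := ih (le_sup_left.trans h)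
    obtain ⟨L', ⟨y', hyL', hy'⟩, hL'⟩ := ih' (le_sup_right.trans h)
    refine ⟨L * L', ⟨y * y', Ideal.mul_mem_mul hyL hyL', mul_mem hy hy'⟩, ?_⟩
    rw [Ideal.sup_mul]
    refine sup_le ?_ ?_
    · rw [← mul_assoc, ← mul_assoc]; exact Ideal.mul_mono_left hL
    · rw [mul_left_comm, mul_left_comm I]; exact Ideal.mul_mono_right hL'

theorem Ideal.isIntegrallyClosedIdeal_regularIntegralClosure [IsNoetherianRing R] {I : Ideal R}
    (hI : ∃ y ∈ I, y ∈ R⁰) : IsIntegrallyClosedIdeal I.regularIntegralClosure := by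
  intro x hx
  obtain ⟨L, ⟨y, hyL, hy⟩, hL⟩ :=
    hx.exists_span_mul_le (hI.imp fun _ h => ⟨I.le_regularIntegralClosure h.1, h.2⟩)
  obtain ⟨L', ⟨y', hyL', hy'⟩, hL'⟩ :=
    Ideal.exists_mul_le_of_le_regularIntegralClosure (IsNoetherian.noetherian _) (le_refl
      I.regularIntegralClosure)
  refine ⟨L * L', ⟨y * y', Ideal.mul_mem_mul hyL hyL', mul_mem hy hy'⟩, ?_⟩
  calc Ideal.span {x} * (L * L') = Ideal.span {x} * L * L' := (mul_assoc _ _ _).symm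
    _ ≤ I.regularIntegralClosure * L * L' := Ideal.mul_mono_left hL
    _ = I.regularIntegralClosure * L' * L := mul_right_comm _ _ _
    _ ≤ I * L' * L := Ideal.mul_mono_left hL'
    _ = I * (L * L') := by rw [mul_assoc, mul_comm L']

end IntegralClosure

section Arf

variable {R : Type*} [CommRing R]

theorem mem_nonZeroDivisors_of_sq_eq_span_mul {J : Ideal R} (hJ : ∃ x ∈ J, x ∈ R⁰) {a : R}
    (h : J ^ 2 = Ideal.span {a} * J) : a ∈ R⁰ := by
  obtain ⟨x, hxJ, hx⟩ := hJ
  have : x ^ 2 ∈ Ideal.span {a} * J := h ▸ Ideal.pow_mem_pow hxJ 2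
  obtain ⟨z, -, hz⟩ := Ideal.mem_span_singleton_mul.mp this
  exact (mul_mem_nonZeroDivisors.mp (hz ▸ pow_mem hx 2 : a * z ∈ R⁰)).1

/-- Division of a linear functional by a nonzerodivisor that divides all its values. -/
theorem exists_linearMap_mul_eq {M : Type*} [AddCommGroup M] [Module R M] {a : R} (ha : a ∈ R⁰)
    (g : M →ₗ[R] R) (h : ∀ m, ∃ r, a * r = g m) : ∃ f : M →ₗ[R] R, ∀ m, a * f m = g m := by
  choose f hf using h
  have hcancel : ∀ {r s : R}, a * r = a * s → r = s := fun h =>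
    (isRegular_iff_mem_nonZeroDivisors.mpr ha).left h
  exact ⟨{ toFun := f
           map_add' := fun m m' => hcancel (by rw [mul_add, hf, hf, hf, map_add])
           map_smul' := fun r m => hcancel (by
             rw [hf, map_smul, ← hf, RingHom.id_apply, smul_eq_mul, smul_eq_mul,
               mul_left_comm]) }, hf⟩

theorem apply_mem_traceIdeal {M : Type*} [AddCommGroup M] [Module R M] (f : M →ₗ[R] R) (m : M) :
    f m ∈ traceIdeal R M :=
  le_iSup (fun f : M →ₗ[R] R => LinearMap.range f) f ⟨m, rfl⟩

/-- Linear functionals on a trace ideal take values in that ideal. -/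
theorem apply_traceIdeal_mem {M : Type*} [AddCommGroup M] [Module R M]
    (f : traceIdeal R M →ₗ[R] R) (x : traceIdeal R M) : f x ∈ traceIdeal R M := by
  have : traceIdeal R M ≤ (Submodule.comap f (traceIdeal R M)).map (traceIdeal R M).subtype := by
    refine iSup_le fun g => ?_
    rintro _ ⟨m, rfl⟩
    exact ⟨⟨g m, apply_mem_traceIdeal g m⟩, apply_mem_traceIdeal (f ∘ₗ g.codRestrict _
      (apply_mem_traceIdeal g)) m, rfl⟩
  obtain ⟨y, hy, hyx⟩ := this x.2
  rwa [← Subtype.ext hyx]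

/-- In a Noetherian Arf ring, an ideal containing a nonzerodivisor that is stable under all its
linear functionals (equivalently, a trace ideal) is integrally closed. -/
theorem IsArfRing.isIntegrallyClosedIdeal_of_apply_mem [IsNoetherianRing R] (hArf : IsArfRing R)
    {J : Ideal R} (hJ : ∃ x ∈ J, x ∈ R⁰) (htr : ∀ (f : J →ₗ[R] R) (x : J), f x ∈ J) :
    IsIntegrallyClosedIdeal J := by
  have hJC := J.le_regularIntegralClosure
  have hCreg : ∃ x ∈ J.regularIntegralClosure, x ∈ R⁰ := hJ.imp fun _ h => ⟨hJC h.1, h.2⟩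
  obtain ⟨a, haC, hsq⟩ := hArf _ (Ideal.isIntegrallyClosedIdeal_regularIntegralClosure hJ) hCreg
  have ha := mem_nonZeroDivisors_of_sq_eq_span_mul hCreg hsq
  have hmul : J.regularIntegralClosure * J ≤ Ideal.span {a} * J := by
    refine Ideal.mul_le.mpr fun c hc j hj => ?_
    obtain ⟨f, hf⟩ := exists_linearMap_mul_eq ha (c • J.subtype) fun y => by
      have : c * (y : R) ∈ Ideal.span {a} * J.regularIntegralClosure :=
        hsq ▸ pow_two J.regularIntegralClosure ▸ Ideal.mul_mem_mul hc (hJC y.2)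
      obtain ⟨z, -, hz⟩ := Ideal.mem_span_singleton_mul.mp this
      exact ⟨z, hz⟩
    exact Ideal.mem_span_singleton_mul.mpr ⟨_, htr f ⟨j, hj⟩, hf ⟨j, hj⟩⟩
  have hpow : ∀ i, J ^ (i + 1) ≤ Ideal.span {a ^ i} * J := by
    intro i
    induction i with
    | zero => simp
    | succ i ih =>
      rw [pow_succ J, pow_succ a, ← Ideal.span_singleton_mul_span_singleton, mul_assoc]
      refine (Ideal.mul_mono_left ih).trans ?_
      rw [mul_assoc]
      exact Ideal.mul_mono_right ((Ideal.mul_mono_left hJC).trans hmul)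
  have haJ : a ∈ J := by
    obtain ⟨L, hL, haL⟩ := haC
    obtain ⟨n, hn, b, hb, hab⟩ := IsIntegralOverIdeal.of_span_mul_le hL haL
    obtain ⟨n, rfl⟩ : ∃ k, n = k + 1 := ⟨n - 1, by omega⟩
    have : a ^ (n + 1) ∈ Ideal.span {a ^ n} * J := by
      rw [eq_neg_of_add_eq_zero_left hab]
      refine neg_mem (sum_mem fun i hi => ?_)
      obtain ⟨hi1, hi2⟩ := Finset.mem_Icc.mp hi
      obtain ⟨i, rfl⟩ : ∃ k, i = k + 1 := ⟨i - 1, by omega⟩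
      obtain ⟨z, hz, hbz⟩ := Ideal.mem_span_singleton_mul.mp (hpow i (hb _ hi1 hi2))
      refine Ideal.mem_span_singleton_mul.mpr ⟨z, hz, ?_⟩
      rw [← hbz, show n = i + (n + 1 - (i + 1)) by omega, pow_add,
        show i + (n + 1 - (i + 1)) + 1 - (i + 1) = n + 1 - (i + 1) by omega]
      ring
    obtain ⟨z, hz, haz⟩ := Ideal.mem_span_singleton_mul.mp this
    rw [pow_succ] at haz
    rwa [← (isRegular_iff_mem_nonZeroDivisors.mpr (pow_mem ha n)).left haz]
  intro x hx
  obtain ⟨L, hL⟩ := hx.exists_span_mul_le hJ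
  obtain ⟨z, hz, haz⟩ := Ideal.mem_span_singleton_mul.mp
    (hmul (Ideal.mul_mem_mul (Ideal.mem_regularIntegralClosure.mpr ⟨L, hL⟩) haJ))
  rw [mul_comm x] at haz
  rwa [← (isRegular_iff_mem_nonZeroDivisors.mpr ha).left haz]

/-- An integrally closed ideal `J` containing a nonzerodivisor is reflexive if `J² = aJ` for some
`a ∈ J`. -/
theorem IsIntegrallyClosedIdeal.isReflexive [IsNoetherianRing R] {J : Ideal R}
    (hJ : IsIntegrallyClosedIdeal J) (hreg : ∃ x ∈ J, x ∈ R⁰) {a : R} (haJ : a ∈ J)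
    (hsq : J ^ 2 = Ideal.span {a} * J) : Module.IsReflexive R J := by
  have ha := mem_nonZeroDivisors_of_sq_eq_span_mul hreg hsq
  have hcancel : ∀ {r s : R}, a * r = a * s → r = s := fun h =>
    (isRegular_iff_mem_nonZeroDivisors.mpr ha).left h
  have hcomm : ∀ (f : Module.Dual R J) (y z : J), (y : R) * f z = z * f y := fun f y z => by
    rw [← smul_eq_mul, ← smul_eq_mul, ← map_smul, ← map_smul]
    exact congrArg f (Subtype.ext (mul_comm _ _))
  refine ⟨⟨fun y z hyz => Subtype.ext (LinearMap.congr_fun hyz J.subtype), fun Φ => ?_⟩⟩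
  have hΦ : ∀ (f : Module.Dual R J) (y : J), (y : R) * Φ f = f y * Φ J.subtype := fun f y => by
    rw [← smul_eq_mul, ← smul_eq_mul, ← map_smul, ← map_smul]
    exact congrArg Φ (LinearMap.ext fun z => by simp [hcomm f y z, mul_comm])
  set q := Φ J.subtype
  let L : Ideal R := LinearMap.range (Module.Dual.eval R J ⟨a, haJ⟩)
  have hΦL : ∀ f, Φ f ∈ L := fun f => by
    obtain ⟨g, hg⟩ := exists_linearMap_mul_eq ha ((Φ f) • J.subtype) fun y => by
      obtain ⟨f', hf'⟩ := exists_linearMap_mul_eq ha ((y : R) • f) fun z => by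
        have : (y * z : R) ∈ Ideal.span {a} * J :=
          hsq ▸ pow_two J ▸ Ideal.mul_mem_mul y.2 z.2
        obtain ⟨w, hw, haw⟩ := Ideal.mem_span_singleton_mul.mp this
        refine ⟨f ⟨w, hw⟩, ?_⟩
        rw [LinearMap.smul_apply, ← map_smul, ← smul_eq_mul, ← map_smul]
        exact congrArg f (Subtype.ext haw)
      refine ⟨Φ f', ?_⟩
      rw [← smul_eq_mul, ← map_smul, LinearMap.smul_apply, Submodule.subtype_apply, smul_eq_mul,
        mul_comm, ← smul_eq_mul, ← map_smul]
      exact congrArg Φ (LinearMap.ext hf')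
    exact ⟨g, hcancel ((hg ⟨a, haJ⟩).trans (mul_comm _ _))⟩
  have hq : q ∈ J := by
    refine hJ q (IsIntegralOverIdeal.of_span_mul_le (L := L) ⟨a, ⟨J.subtype, rfl⟩, ha⟩ ?_)
    refine Ideal.span_singleton_mul_le_iff.mpr ?_
    rintro _ ⟨f, rfl⟩
    rw [Module.Dual.eval_apply, mul_comm q, ← hΦ f ⟨a, haJ⟩]
    exact Ideal.mul_mem_mul haJ (hΦL f)
  refine ⟨⟨q, hq⟩, LinearMap.ext fun f => hcancel ?_⟩
  rw [Module.Dual.eval_apply, hcomm f ⟨a, haJ⟩ ⟨q, hq⟩, hΦ f ⟨a, haJ⟩, mul_comm]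

end Arf

section Reflexive

variable {R : Type*} [CommRing R]

theorem finite_maximalSpectrum_of_module_finite (B : Type*) [CommRing B] [Algebra R B]
    [Module.Finite R B] [Finite (MaximalSpectrum R)] : Finite (MaximalSpectrum B) := by
  have hfin : (⋃ m : MaximalSpectrum R, m.asIdeal.primesOver B).Finite :=
    Set.finite_iUnion fun m => Algebra.QuasiFinite.finite_primesOver m.asIdeal
  have hmem : ∀ n : MaximalSpectrum B,
      n.asIdeal ∈ ⋃ m : MaximalSpectrum R, m.asIdeal.primesOver B := fun n => by
    have := n.isMaximal
    exact Set.mem_iUnion.mpr ⟨⟨n.asIdeal.under R, Ideal.IsMaximal.under R n.asIdeal⟩,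
      this.isPrime, ⟨rfl⟩⟩
  have := hfin.to_subtype
  exact Finite.of_injective (fun n => (⟨n.asIdeal, hmem n⟩ : ↥(⋃ m : MaximalSpectrum R,
    m.asIdeal.primesOver B))) fun n n' h => MaximalSpectrum.ext (Subtype.ext_iff.mp h)

/-- The subalgebra of `Q` of multipliers of an `R`-submodule. -/
def Submodule.multiplierSubalgebra {Q : Type*} [CommRing Q] [Algebra R Q] (T : Submodule R Q) :
    Subalgebra R Q where
  carrier := {q | ∀ t ∈ T, q * t ∈ T}
  mul_mem' hq hq' t ht := by rw [mul_assoc]; exact hq _ (hq' t ht)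
  add_mem' hq hq' t ht := by rw [add_mul]; exact add_mem (hq t ht) (hq' t ht)
  algebraMap_mem' r t ht := by rw [← Algebra.smul_def]; exact T.smul_mem r ht

variable (Q : Type*) [CommRing Q] [Algebra R Q] [IsFractionRing R Q]

open IsLocalization

theorem IsFractionRing.exists_mul_eq_apply {I : Ideal R} (hI : ∃ x ∈ I, x ∈ R⁰) (f : I →ₗ[R] R) :
    ∃ q : Q, ∀ y : I, q * algebraMap R Q y = algebraMap R Q (f y) := by
  obtain ⟨x, hxI, hx⟩ := hI
  refine ⟨mk' Q (f ⟨x, hxI⟩) ⟨x, hx⟩, fun y => ?_⟩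
  rw [mul_comm, mul_mk'_eq_mk'_of_mul, mk'_eq_iff_eq_mul, ← map_mul]
  congr 1
  rw [← smul_eq_mul, ← map_smul, mul_comm, ← smul_eq_mul, ← map_smul]
  exact congrArg f (Subtype.ext (mul_comm _ _))

theorem IsFractionRing.exists_apply_eq_mul {I : Ideal R} {q : Q}
    (hq : q ∈ (1 / coeSubmodule Q I : Submodule R Q)) :
    ∃ f : I →ₗ[R] R, ∀ y : I, algebraMap R Q (f y) = q * algebraMap R Q y := by
  have h : ∀ y : I, ∃ r, algebraMap R Q r = q * algebraMap R Q y := fun y =>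
    Submodule.mem_one.mp (Submodule.mem_div_iff_forall_mul_mem.mp hq _
      ((mem_coeSubmodule Q I).mpr ⟨y, y.2, rfl⟩))
  choose f hf using h
  have hinj := IsFractionRing.injective R Q
  exact ⟨{ toFun := f
           map_add' := fun y z => hinj (by simp [hf, mul_add])
           map_smul' := fun r y => hinj (by simp [hf, mul_left_comm]) }, hf⟩

theorem coeSubmodule_traceIdeal {I : Ideal R} (hI : ∃ x ∈ I, x ∈ R⁰) :
    coeSubmodule Q (traceIdeal R I) = coeSubmodule Q I * (1 / coeSubmodule Q I) := by
  apply le_antisymm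
  · rw [coeSubmodule, traceIdeal, Submodule.map_iSup]
    refine iSup_le fun f => ?_
    rintro _ ⟨_, ⟨y, rfl⟩, rfl⟩
    obtain ⟨q, hq⟩ := IsFractionRing.exists_mul_eq_apply Q hI f
    rw [Algebra.linearMap_apply, ← hq, mul_comm q]
    refine Submodule.mul_mem_mul ((mem_coeSubmodule Q I).mpr ⟨y, y.2, rfl⟩)
      (Submodule.mem_div_iff_forall_mul_mem.mpr fun z hz => ?_)
    obtain ⟨z, hzI, rfl⟩ := (mem_coeSubmodule Q I).mp hz
    exact Submodule.mem_one.mpr ⟨f ⟨z, hzI⟩, (hq ⟨z, hzI⟩).symm⟩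
  · refine Submodule.mul_le.mpr fun y hy q hq => ?_
    obtain ⟨y, hyI, rfl⟩ := (mem_coeSubmodule Q I).mp hy
    obtain ⟨f, hf⟩ := IsFractionRing.exists_apply_eq_mul Q hq
    rw [mul_comm, ← hf ⟨y, hyI⟩]
    exact (mem_coeSubmodule Q _).mpr ⟨_, apply_mem_traceIdeal f ⟨y, hyI⟩, rfl⟩

theorem mem_coeSubmodule_of_isReflexive {I : Ideal R} (hI : ∃ x ∈ I, x ∈ R⁰)
    [Module.IsReflexive R I] {q : Q}
    (hq : ∀ d ∈ (1 / coeSubmodule Q I : Submodule R Q), q * d ∈ (1 : Submodule R Q)) :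
    q ∈ coeSubmodule Q I := by
  have hinj := IsFractionRing.injective R Q
  obtain ⟨x, hxI, hx⟩ := hI
  obtain ⟨n, s, rfl⟩ := exists_mk'_eq R⁰ q
  have hsx : (s * x : R) ∈ R⁰ := mul_mem s.2 hx
  obtain ⟨Φ, hΦ⟩ := exists_linearMap_mul_eq hsx (n • Module.Dual.eval R I ⟨x, hxI⟩) fun f => by
    obtain ⟨d, hd⟩ := IsFractionRing.exists_mul_eq_apply Q ⟨x, hxI, hx⟩ f
    obtain ⟨r, hr⟩ := Submodule.mem_one.mp (hq d (Submodule.mem_div_iff_forall_mul_mem.mpr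
      fun z hz => by
        obtain ⟨z, hzI, rfl⟩ := (mem_coeSubmodule Q I).mp hz
        exact Submodule.mem_one.mpr ⟨f ⟨z, hzI⟩, (hd ⟨z, hzI⟩).symm⟩))
    refine ⟨r, hinj ?_⟩
    rw [LinearMap.smul_apply, Module.Dual.eval_apply, smul_eq_mul, map_mul, map_mul, map_mul, hr,
      ← hd ⟨x, hxI⟩, ← mk'_spec Q n s]
    ring
  obtain ⟨y, hy⟩ := (Module.bijective_dual_eval R I).2 Φ
  refine (mem_coeSubmodule Q I).mpr ⟨y, y.2, ?_⟩
  rw [eq_mk'_iff_mul_eq, ← map_mul]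
  congr 1
  have := hΦ I.subtype
  rw [← hy] at this
  refine (isRegular_iff_mem_nonZeroDivisors.mpr hx).left ?_
  simp only [Module.Dual.eval_apply, Submodule.subtype_apply, LinearMap.smul_apply,
    smul_eq_mul] at this
  linear_combination this

/-- The underlying `B`-submodule of an `R`-submodule of `Q` that is stable under a
subalgebra `B`. -/
def Submodule.ofSubalgebraStable {Q : Type*} [CommRing Q] [Algebra R Q] (B : Subalgebra R Q)
    (N : Submodule R Q) (h : ∀ b ∈ B, ∀ y ∈ N, b * y ∈ N) : Submodule B Q where
  carrier := N
  zero_mem' := N.zero_mem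
  add_mem' := N.add_mem
  smul_mem' b y hy := h b b.2 y hy

/-- A Picard group argument: if `N * N' = u B` for `B`-stable submodules `N`, `N'` of `Q` and a
unit `u`, where `B` is a finite algebra over a semilocal ring, then `N` is isomorphic to `B`. -/
theorem nonempty_linearEquiv_of_mul_eq [Finite (MaximalSpectrum R)] {Q : Type*} [CommRing Q]
    [Algebra R Q] (B : Subalgebra R Q) [Module.Finite R B] (N N' : Submodule R Q)
    (hN : ∀ b ∈ B, ∀ y ∈ N, b * y ∈ N) (hN' : ∀ b ∈ B, ∀ y ∈ N', b * y ∈ N') (u : Qˣ)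
    (huB : ∀ q, q ∈ B ↔ (u : Q) * q ∈ N * N') : Nonempty (N ≃ₗ[R] B) := by
  have := finite_maximalSpectrum_of_module_finite (R := R) B
  let P : Submodule B Q := .ofSubalgebraStable B N hN
  let P' : Submodule B Q := .ofSubalgebraStable B (N'.map (LinearMap.mulLeft R (↑u⁻¹ : Q))) (by
    rintro b hb _ ⟨y, hy, rfl⟩
    exact ⟨b * y, hN' b hb y hy, by simp [mul_left_comm]⟩)
  have hPP' : P * P' = 1 := by
    apply le_antisymm
    · refine Submodule.mul_le.mpr ?_
      rintro y hy _ ⟨d, hd, rfl⟩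
      refine Submodule.mem_one.mpr ⟨⟨y * (↑u⁻¹ * d), (huB _).mpr ?_⟩, rfl⟩
      rw [mul_left_comm, Units.mul_inv_cancel_left]
      exact Submodule.mul_mem_mul hy hd
    · refine Submodule.one_le.mpr ?_
      have key : ∀ t ∈ N * N', ↑u⁻¹ * t ∈ P * P' := fun t ht => by
        induction ht using Submodule.mul_induction_on' with
        | mem_mul_mem y hy d hd =>
          rw [mul_left_comm]
          exact Submodule.mul_mem_mul (M := P) (N := P') hy ⟨d, hd, rfl⟩
        | add t _ t' _ ht ht' => rw [mul_add]; exact add_mem ht ht'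
      simpa using key _ ((huB 1).mp (one_mem B))
  let U : (Submodule B Q)ˣ := ⟨P, P', hPP', mul_comm P P' ▸ hPP'⟩
  have : FaithfulSMul B Q :=
    (faithfulSMul_iff_algebraMap_injective B Q).mpr Subtype.val_injective
  have : Module.Invertible B P :=
    .left (Submodule.tensorInvEquiv U)
  obtain ⟨e⟩ := Module.Invertible.free_iff_linearEquiv.mp (inferInstance : Module.Free B P)
  exact ⟨{ toFun := fun y => e ⟨y, y.2⟩
           invFun := fun b => ⟨e.symm b, (e.symm b).2⟩
           map_add' := fun y z => e.map_add ⟨y, y.2⟩ ⟨z, z.2⟩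
           map_smul' := fun r y => by
             have : (⟨↑(r • y), (r • y).2⟩ : P) = (algebraMap R B r) • (⟨y, y.2⟩ : P) :=
               Subtype.ext (Algebra.smul_def r (y : Q))
             rw [this, map_smul, RingHom.id_apply, algebraMap_smul]
           left_inv := fun y => Subtype.ext (by simp)
           right_inv := fun b => e.apply_symm_apply b }⟩

/-- Over a semilocal Noetherian Arf ring, a reflexive ideal containing a nonzerodivisor is
isomorphic to its trace ideal. -/
theorem IsArfRing.nonempty_linearEquiv_traceIdeal [IsNoetherianRing R]
    [Finite (MaximalSpectrum R)] (hArf : IsArfRing R) {I : Ideal R} (hI : ∃ x ∈ I, x ∈ R⁰)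
    [Module.IsReflexive R I] : Nonempty (I ≃ₗ[R] traceIdeal R I) := by
  let Q := FractionRing R
  have hinj := IsFractionRing.injective R Q
  have hT : ∃ x ∈ traceIdeal R I, x ∈ R⁰ :=
    hI.imp fun x h => ⟨apply_mem_traceIdeal I.subtype ⟨x, h.1⟩, h.2⟩
  obtain ⟨a, haT, hsq⟩ :=
    hArf _ (hArf.isIntegrallyClosedIdeal_of_apply_mem hT apply_traceIdeal_mem) hT
  have ha := mem_nonZeroDivisors_of_sq_eq_span_mul hT hsq
  let u : Qˣ := (IsLocalization.map_units Q (⟨a, ha⟩ : R⁰)).unit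
  have hu : (u : Q) = algebraMap R Q a := rfl
  let D : Submodule R Q := 1 / coeSubmodule Q I
  have hTQ : coeSubmodule Q (traceIdeal R I) = coeSubmodule Q I * D := coeSubmodule_traceIdeal Q hI
  let B : Subalgebra R Q := (coeSubmodule Q (traceIdeal R I)).multiplierSubalgebra
  have hB : ∀ q, q ∈ B ↔ ∀ t ∈ coeSubmodule Q I * D, q * t ∈ coeSubmodule Q I * D := by
    rw [← hTQ]; exact fun q => Iff.rfl
  have hle : coeSubmodule Q I * D ≤ 1 := Submodule.mul_one_div_le_one
  have hBI : ∀ b ∈ B, ∀ y ∈ coeSubmodule Q I, b * y ∈ coeSubmodule Q I := fun b hb y hy =>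
    mem_coeSubmodule_of_isReflexive Q hI fun d hd => by
      rw [mul_assoc]; exact hle ((hB b).mp hb _ (Submodule.mul_mem_mul hy hd))
  have hBD : ∀ b ∈ B, ∀ d ∈ D, b * d ∈ D := fun b hb d hd =>
    Submodule.mem_div_iff_forall_mul_mem.mpr fun y hy => by
      rw [mul_assoc, mul_comm d]; exact hle ((hB b).mp hb _ (Submodule.mul_mem_mul hy hd))
  have huB : ∀ q, q ∈ B ↔ (u : Q) * q ∈ coeSubmodule Q I * D := fun q => by
    rw [← hTQ]
    refine ⟨fun hq => mul_comm q u ▸ hq _ ((mem_coeSubmodule Q _).mpr ⟨a, haT, rfl⟩),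
      fun hq t ht => ?_⟩
    have h1 := Submodule.mul_mem_mul hq ht
    rw [← coeSubmodule_mul, ← pow_two, hsq] at h1
    obtain ⟨_, h2, h3⟩ := (mem_coeSubmodule Q _).mp h1
    obtain ⟨z, hz, rfl⟩ := Ideal.mem_span_singleton_mul.mp h2
    refine (mem_coeSubmodule Q _).mpr ⟨z, hz, u.isUnit.mul_left_cancel ?_⟩
    rw [hu, ← map_mul, h3, hu, mul_assoc]
  let eB : B ≃ₗ[R] coeSubmodule Q (traceIdeal R I) :=
    { toFun := fun q => ⟨u * q, hTQ ▸ (huB q).mp q.2⟩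
      invFun := fun t => ⟨↑u⁻¹ * t, (huB _).mpr (by
        rw [Units.mul_inv_cancel_left, ← hTQ]; exact t.2)⟩
      map_add' := fun q q' => Subtype.ext (mul_add _ _ _)
      map_smul' := fun r q => Subtype.ext (mul_smul_comm _ _ _)
      left_inv := fun q => Subtype.ext (Units.inv_mul_cancel_left _ _)
      right_inv := fun t => Subtype.ext (Units.mul_inv_cancel_left _ _) }
  let eI (K : Ideal R) : K ≃ₗ[R] coeSubmodule Q K :=
    Submodule.equivMapOfInjective (Algebra.linearMap R Q) hinj K
  have : Module.Finite R B := .equiv ((eI _).trans eB.symm)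
  obtain ⟨e⟩ := nonempty_linearEquiv_of_mul_eq B (coeSubmodule Q I) D hBI hBD u huB
  exact ⟨(eI I).trans (e.trans (eB.trans (eI _).symm))⟩

end Reflexive

theorem Ideal.exists_mem_nonZeroDivisors_of_linearEquiv {R : Type*} [CommRing R] {I J : Ideal R}
    (hI : ∃ x ∈ I, x ∈ nonZeroDivisors R) (e : I ≃ₗ[R] J) : ∃ x ∈ J, x ∈ nonZeroDivisors R := by
  obtain ⟨x, hxI, hx⟩ := hI
  refine ⟨e ⟨x, hxI⟩, (e ⟨x, hxI⟩).2, mem_nonZeroDivisors_iff_right.mpr fun r hr => ?_⟩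
  have : r • (⟨x, hxI⟩ : I) = 0 := e.injective (by rw [map_smul, map_zero]; exact Subtype.ext hr)
  exact (mem_nonZeroDivisors_iff.mp hx).2 r (congrArg Subtype.val this)

/-- Let `R` be a one-dimensional Cohen-Macaulay semi-local Arf ring and `I` an ideal of
`R` containing a nonzerodivisor. Then the following are equivalent:
(a) `I` is isomorphic as an `R`-module to some trace ideal of `R`;
(b) `I` is isomorphic as an `R`-module to some integrally closed ideal of `R`;
(c) `I` is reflexive as an `R`-module. -/
theorem trace_int_closed_reflexive_tfae {R : Type} [CommRing R]
    (hR : IsOneDimCMSemiLocal R) (hArf : IsArfRing R) (I : Ideal R)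
    (hnzd : ∃ x ∈ I, x ∈ nonZeroDivisors R) :
    ((∃ J : Ideal R,
        (∃ (M : Type) (_ : AddCommGroup M) (_ : Module R M),
          Module.Finite R M ∧ J = traceIdeal R M) ∧
        Nonempty (↥I ≃ₗ[R] ↥J)) ↔
      (∃ J : Ideal R, IsIntegrallyClosedIdeal J ∧ Nonempty (↥I ≃ₗ[R] ↥J))) ∧
    ((∃ J : Ideal R, IsIntegrallyClosedIdeal J ∧ Nonempty (↥I ≃ₗ[R] ↥J)) ↔
      Module.IsReflexive R ↥I) := by
  obtain ⟨hNoeth, hfin, -⟩ := hR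
  have : Finite (MaximalSpectrum R) := by
    have := hfin.to_subtype
    exact Finite.of_injective
      (fun m => (⟨m.asIdeal, m.isMaximal⟩ : {I : Ideal R | I.IsMaximal}))
      fun m n h => MaximalSpectrum.ext (Subtype.ext_iff.mp h)
  have trace_to_closed : ∀ J : Ideal R, (∃ (M : Type) (_ : AddCommGroup M) (_ : Module R M),
      Module.Finite R M ∧ J = traceIdeal R M) → Nonempty (I ≃ₗ[R] J) →
      IsIntegrallyClosedIdeal J := by
    rintro _ ⟨M, _, _, -, rfl⟩ ⟨e⟩
    exact hArf.isIntegrallyClosedIdeal_of_apply_mem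
      (Ideal.exists_mem_nonZeroDivisors_of_linearEquiv hnzd e) apply_traceIdeal_mem
  have closed_to_reflexive : ∀ J : Ideal R, IsIntegrallyClosedIdeal J → Nonempty (I ≃ₗ[R] J) →
      Module.IsReflexive R I := by
    rintro J hJ ⟨e⟩
    have hreg := Ideal.exists_mem_nonZeroDivisors_of_linearEquiv hnzd e
    obtain ⟨a, haJ, hsq⟩ := hArf J hJ hreg
    have := hJ.isReflexive hreg haJ hsq
    exact Module.equiv e.symm
  have reflexive_to_trace : Module.IsReflexive R I → ∃ J : Ideal R,
      (∃ (M : Type) (_ : AddCommGroup M) (_ : Module R M),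
        Module.Finite R M ∧ J = traceIdeal R M) ∧ Nonempty (I ≃ₗ[R] J) := fun _ =>
    ⟨traceIdeal R I, ⟨I, inferInstance, inferInstance, inferInstance, rfl⟩,
      hArf.nonempty_linearEquiv_traceIdeal hnzd⟩
  refine ⟨⟨?_, ?_⟩, ?_, fun h => ?_⟩
  · rintro ⟨J, hJ, e⟩
    exact ⟨J, trace_to_closed J hJ e, e⟩
  · rintro ⟨J, hJ, e⟩
    exact reflexive_to_trace (closed_to_reflexive J hJ e)
  · rintro ⟨J, hJ, e⟩
    exact closed_to_reflexive J hJ e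
  · obtain ⟨J, hJ, e⟩ := reflexive_to_trace h
    exact ⟨J, trace_to_closed J hJ e, e⟩
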